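/- arXiv:1406.6519 — 2 statements merged into one kernel-verified Lean document; each statement's English description precedes it below -/
import Mathlib

section
/- Let (X, μ) be a measure space, let β > 0, and let f, g : X → [0, ∞) be measurable functions such that f^{1+β}, f^β·g, and g^{1+β} are μ-integrable. Define d_β(g, f) = ∫ ( f^{1+β} − (1 + 1/β)·f^β·g + (1/β)·g^{1+β} ) dμ. Then d_β(g, f) ≥ 0, and d_β(g, f) = 0 if and only if f = g μ-almost everywhere. -/
open MeasureTheory

lemma dpd_pt_eq (β : ℝ) (hβ : 0 < β) (a : ℝ) (ha : 0 ≤ a) :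
    a ^ (1 + β) - (1 + 1 / β) * a ^ β * a + (1 / β) * a ^ (1 + β) = 0 := by
  have h : a ^ (1 + β) = a * a ^ β := by
    rw [Real.rpow_add' ha (by positivity), Real.rpow_one]
  rw [h]; ring

lemma dpd_pt_pos (β : ℝ) (hβ : 0 < β) (a b : ℝ) (ha : 0 ≤ a) (hb : 0 ≤ b) (hab : a ≠ b) :
    0 < a ^ (1 + β) - (1 + 1 / β) * a ^ β * b + (1 / β) * b ^ (1 + β) := by
  rcases ha.eq_or_lt with rfl | ha'
  · have hb' : 0 < b := lt_of_le_of_ne hb hab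
    rw [Real.zero_rpow (by positivity), Real.zero_rpow hβ.ne']
    have := Real.rpow_pos_of_pos hb' (1 + β)
    simp only [mul_zero, zero_mul, sub_zero, zero_add]
    positivity
  · obtain ⟨t, rfl⟩ : ∃ t, b = a * t := ⟨b / a, by field_simp⟩
    have ht : 0 ≤ t := nonneg_of_mul_nonneg_right hb ha'
    have ht1 : t - 1 ≠ 0 := by
      intro h
      apply hab
      rw [show t = 1 by linarith, mul_one]
    have key := one_add_mul_self_lt_rpow_one_add (s := t - 1) (by linarith) ht1
      (p := 1 + β) (by linarith)
    rw [show 1 + (t - 1) = t by ring] at key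
    have h : a ^ (1 + β) = a * a ^ β := by
      rw [Real.rpow_add' ha (by positivity), Real.rpow_one]
    have hp := Real.rpow_pos_of_pos ha' β
    rw [Real.mul_rpow ha ht, h]
    have e : a * a ^ β - (1 + 1 / β) * a ^ β * (a * t) + 1 / β * (a * a ^ β * t ^ (1 + β))
        = a * a ^ β / β * (t ^ (1 + β) - (1 + (1 + β) * (t - 1))) := by
      generalize t ^ (1 + β) = u
      generalize a ^ β = v
      field_simp
      ring
    rw [e]
    exact mul_pos (by positivity) (by linarith)

/-- **Nonnegativity and identifiability of the density power divergence.**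
Let `(X, μ)` be a measure space, `β > 0`, and `f, g : X → [0, ∞)` measurable with
`f^{1+β}`, `f^β g` and `g^{1+β}` integrable.  Then
`d_β(g,f) = ∫ (f^{1+β} − (1+1/β) f^β g + (1/β) g^{1+β}) dμ ≥ 0`, with
`d_β(g,f) = 0` iff `f = g` almost everywhere. -/
theorem dpd_nonneg_iff_ae_eq
    {X : Type*} [MeasurableSpace X] (μ : Measure X)
    (β : ℝ) (hβ : 0 < β)
    (f g : X → ℝ) (hf : Measurable f) (hg : Measurable g)
    (hf0 : ∀ x, 0 ≤ f x) (hg0 : ∀ x, 0 ≤ g x)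
    (hif : Integrable (fun x => f x ^ (1 + β)) μ)
    (hifg : Integrable (fun x => f x ^ β * g x) μ)
    (hig : Integrable (fun x => g x ^ (1 + β)) μ)
    (d : ℝ)
    (hd : d = ∫ x, (f x ^ (1 + β) - (1 + 1 / β) * f x ^ β * g x +
        (1 / β) * g x ^ (1 + β)) ∂μ) :
    0 ≤ d ∧ (d = 0 ↔ f =ᵐ[μ] g) := by
  have hnn : ∀ x, 0 ≤ f x ^ (1 + β) - (1 + 1 / β) * f x ^ β * g x +
        (1 / β) * g x ^ (1 + β) := by
    intro x
    by_cases h : f x = g x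
    · rw [← h, dpd_pt_eq β hβ _ (hf0 x)]
    · exact (dpd_pt_pos β hβ _ _ (hf0 x) (hg0 x) h).le
  have hint : Integrable (fun x => f x ^ (1 + β) - (1 + 1 / β) * f x ^ β * g x +
        (1 / β) * g x ^ (1 + β)) μ := by
    have h2 : Integrable (fun x => (1 + 1 / β) * f x ^ β * g x) μ := by
      simpa only [mul_assoc] using hifg.const_mul (1 + 1 / β)
    exact (hif.sub h2).add (hig.const_mul (1 / β))
  subst hd
  refine ⟨integral_nonneg hnn, ?_⟩
  rw [integral_eq_zero_iff_of_nonneg hnn hint]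
  constructor
  · intro h
    filter_upwards [h] with x hx
    by_contra hne
    exact (dpd_pt_pos β hβ _ _ (hf0 x) (hg0 x) hne).ne' hx
  · intro h
    filter_upwards [h] with x hx
    simp only [Pi.zero_apply]
    rw [← hx, dpd_pt_eq β hβ _ (hf0 x)]
end

section
/- Let σ > 0 and θ₀ ∈ ℝ. For every β > 0, the function x ↦ (x − θ₀)·exp(−β·(x − θ₀)²/(2σ²)) is bounded on ℝ, and the supremum of its absolute value equals σ/√(β·e). For β = 0 the corresponding function x ↦ x − θ₀ is unbounded on ℝ. -/
/-- **Boundedness of the influence function in the normal location model.**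
For `σ > 0`, `θ₀ ∈ ℝ` and every `β > 0`, the function
`x ↦ (x − θ₀) exp(−β (x − θ₀)² / (2σ²))` is bounded on `ℝ` with
`sup_x |·| = σ / √(β e)`; for `β = 0` the function `x ↦ x − θ₀` is unbounded. -/
theorem normal_location_IF_bounded
    (σ θ₀ : ℝ) (hσ : 0 < σ) :
    (∀ β : ℝ, 0 < β →
      (∃ M : ℝ, ∀ x : ℝ,
          |(x - θ₀) * Real.exp (-β * (x - θ₀) ^ 2 / (2 * σ ^ 2))| ≤ M) ∧
      (⨆ x : ℝ, |(x - θ₀) * Real.exp (-β * (x - θ₀) ^ 2 / (2 * σ ^ 2))|) =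
        σ / Real.sqrt (β * Real.exp 1)) ∧
    ¬ ∃ M : ℝ, ∀ x : ℝ, |x - θ₀| ≤ M := by
  have key : ∀ β : ℝ, 0 < β → ∀ x : ℝ,
      |(x - θ₀) * Real.exp (-β * (x - θ₀) ^ 2 / (2 * σ ^ 2))| ≤
        σ / Real.sqrt (β * Real.exp 1) := by
    intro β hβ x
    apply abs_le_of_sq_le_sq _ (by positivity)
    rw [div_pow, Real.sq_sqrt (by positivity), mul_pow, ← Real.exp_nat_mul]
    have hu := Real.add_one_le_exp (β * (x - θ₀) ^ 2 / σ ^ 2 - 1)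
    have he : ((2 : ℕ) : ℝ) * (-β * (x - θ₀) ^ 2 / (2 * σ ^ 2))
        = -(β * (x - θ₀) ^ 2 / σ ^ 2) := by
      push_cast
      field_simp
    have hy : (x - θ₀) ^ 2 = (β * (x - θ₀) ^ 2 / σ ^ 2) * (σ ^ 2 / β) := by
      field_simp
    rw [he]
    generalize β * (x - θ₀) ^ 2 / σ ^ 2 = u at *
    rw [hy]
    have h2 : u * Real.exp (-u) ≤ Real.exp (-1) := by
      calc u * Real.exp (-u) ≤ Real.exp (u - 1) * Real.exp (-u) := by
            gcongr
            linarith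
        _ = Real.exp (-1) := by
            rw [← Real.exp_add]
            congr 1
            ring
    calc u * (σ ^ 2 / β) * Real.exp (-u) = (σ ^ 2 / β) * (u * Real.exp (-u)) := by ring
      _ ≤ (σ ^ 2 / β) * Real.exp (-1) := by gcongr
      _ = σ ^ 2 / (β * Real.exp 1) := by
          rw [Real.exp_neg]
          field_simp
  refine ⟨fun β hβ => ⟨⟨_, key β hβ⟩, le_antisymm (ciSup_le (key β hβ)) ?_⟩, ?_⟩
  · refine le_trans (le_of_eq ?_)
      (le_ciSup ⟨_, Set.forall_mem_range.2 (key β hβ)⟩ (θ₀ + σ / Real.sqrt β))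
    have hs : 0 < Real.sqrt β := Real.sqrt_pos.2 hβ
    have h1 : -β * (θ₀ + σ / Real.sqrt β - θ₀) ^ 2 / (2 * σ ^ 2) = -(1 / 2) := by
      rw [add_sub_cancel_left, div_pow, Real.sq_sqrt hβ.le]
      field_simp
    simp only [h1]
    rw [add_sub_cancel_left, abs_of_pos (by positivity), Real.sqrt_mul hβ.le,
      ← Real.exp_half, Real.exp_neg]
    field_simp
  · rintro ⟨M, hM⟩
    have h := hM (θ₀ + (|M| + 1))
    rw [add_sub_cancel_left, abs_of_pos (by positivity)] at h
    linarith [le_abs_self M]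
end
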